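/- Let M = (M^m)_{m≥0} be a mould with M^0 = 0 and M^1 = 0 which is alternal and such that swap(M) + C is alternil for some constant mould C. Then the identity ũ(M)^4(x_4,x_1,x_2,x_3) = ũ(M)^4(−x_1,−x_2,−x_3,−x_4) + coll^4_{2,3}(ũ(M))(−x_1,−x_2,−x_3,−x_4) − coll^4_{2,3}(ũ(M))(−x_1,−x_4,−x_3,−x_2) holds in ℚ(x_1,x_2,x_3,x_4). -/

import Mathlib

open MvPolynomial
open scoped TensorProduct

open MvPolynomial

/-- A mould: a family `M = (M^m)_{m ≥ 0}` with `M^m ∈ ℚ[x_1,…,x_m]`. -/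
abbrev Mould : Type := (m : ℕ) → MvPolynomial (Fin m) ℚ

/-- Evaluation of the depth-`m` component of a mould at a vector `v`. -/
noncomputable def mEval {K : Type} [CommRing K] (f : ℚ →+* K) (M : Mould) {m : ℕ}
    (v : Fin m → K) : K :=
  MvPolynomial.eval₂ f v (M m)

/-- The rational function field `ℚ(x_1,…,x_n)`. -/
abbrev FF (n : ℕ) : Type := FractionRing (MvPolynomial (Fin n) ℚ)

/-- The variable `x_i` as an element of `ℚ(x_1,…,x_n)`. -/
noncomputable def xv {n : ℕ} (i : Fin n) : FF n :=
  algebraMap (MvPolynomial (Fin n) ℚ) (FF n) (X i)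

/-- Ecalle's senary relation at depth `r = s+1`, as an identity in `ℚ(y_1,…,y_r)`:
`M^r(y_1,…,y_r) + (M^{r-1}(y_1,…,y_{r-2},y_{r-1}+y_r) - M^{r-1}(y_1,…,y_{r-1}))/y_r
 = M^r(-y_1-⋯-y_r, y_1,…,y_{r-1})
   + (M^{r-1}(-y_2-⋯-y_r, y_2,…,y_{r-1}) - M^{r-1}(y_1,…,y_{r-1}))/(y_1+⋯+y_r)`. -/
noncomputable def SenaryAt (M : Mould) (s : ℕ) : Prop :=
  mEval (Rat.castHom (FF (s+1))) M (fun i : Fin (s+1) => xv i)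
    + (mEval (Rat.castHom (FF (s+1))) M (fun i : Fin s =>
          if i.val = s - 1 then xv (⟨s-1, by omega⟩ : Fin (s+1)) + xv (Fin.last s)
          else xv i.castSucc)
       - mEval (Rat.castHom (FF (s+1))) M (fun i : Fin s => xv i.castSucc)) / xv (Fin.last s)
  = mEval (Rat.castHom (FF (s+1))) M (fun i : Fin (s+1) =>
        if i.val = 0 then -(∑ j : Fin (s+1), xv j)
        else xv (⟨i.val - 1, by have := i.isLt; omega⟩ : Fin (s+1)))
    + (mEval (Rat.castHom (FF (s+1))) M (fun i : Fin s =>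
          if i.val = 0 then -(∑ j : Fin s, xv j.succ) else xv i.castSucc)
       - mEval (Rat.castHom (FF (s+1))) M (fun i : Fin s => xv i.castSucc))
      / (∑ j : Fin (s+1), xv j)
/-- Evaluation of `ũ(M)^{m+1}` (where `ũ = t̃ ∘ swap`):
`ũ(M)^{m+1}(v_1,…,v_{m+1}) = M^m(v_{m+1}-v_1, v_m-v_{m+1}, v_{m-1}-v_m, …, v_2-v_3)`. -/
noncomputable def uEval {K : Type} [CommRing K] (f : ℚ →+* K) (M : Mould) {m : ℕ}
    (v : Fin (m+1) → K) : K :=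
  mEval f M (fun j : Fin m =>
    if h : j.val = 0 then v (Fin.last m) - v 0
    else v ⟨m - j.val, by omega⟩ - v ⟨m - j.val + 1, by have := j.isLt; omega⟩)

/-- `coll^{t+2}_{i,i+1}` (with `1`-indexed `i = k+1`) applied to `N = ũ(M)`,
evaluated at `v = (x_1,…,x_{t+2})`:
`(N^{t+1}(x_1,…,x_i,x_{i+2},…) - N^{t+1}(x_1,…,x_{i-1},x_{i+1},x_{i+2},…))/(x_i - x_{i+1})`. -/
noncomputable def collUEval {K : Type} [Field K] (f : ℚ →+* K) (M : Mould) {t : ℕ}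
    (k : Fin (t+1)) (v : Fin (t+2) → K) : K :=
  (uEval f M (fun j : Fin (t+1) => v (Fin.succAbove k.succ j))
    - uEval f M (fun j : Fin (t+1) => v (Fin.succAbove k.castSucc j)))
    / (v k.castSucc - v k.succ)
/-- The swap of a mould: `swap(M)^m(v_1,…,v_m) = M^m(v_m, v_{m-1}-v_m, …, v_1-v_2)`. -/
noncomputable def swapM (M : Mould) : Mould := fun m =>
  MvPolynomial.eval₂ MvPolynomial.C
    (fun i : Fin m =>
      (MvPolynomial.X ⟨m - 1 - i.val, by have := i.isLt; omega⟩ : MvPolynomial (Fin m) ℚ)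
        - (if h : i.val = 0 then 0
           else MvPolynomial.X ⟨m - i.val, by have := i.isLt; omega⟩))
    (M m)

open scoped Classical in
/-- Alternality of a mould: `M^0 = 0` and for all `p, q ≥ 1` the sum of
`M^{p+q}(x_{σ(1)},…,x_{σ(p+q)})` over the `(p,q)`-shuffle permutations vanishes. -/
noncomputable def IsAlternal (M : Mould) : Prop :=
  M 0 = 0 ∧ ∀ p q : ℕ, 1 ≤ p → 1 ≤ q →
    ∑ σ : Equiv.Perm (Fin (p+q)),
      (if ((∀ i j : Fin (p+q), i < j → j.val < p → σ.symm i < σ.symm j) ∧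
           (∀ i j : Fin (p+q), i < j → p ≤ i.val → σ.symm i < σ.symm j))
       then MvPolynomial.eval₂ MvPolynomial.C
              (fun i => (X (σ i) : MvPolynomial (Fin (p+q)) ℚ)) (M (p+q))
       else 0) = 0

/-- The field `ℚ(y_1, y_2, …)` (the variable `X i` stands for `y_{i+1}`). -/
abbrev Kinf : Type := FractionRing (MvPolynomial ℕ ℚ)

noncomputable def yvar (i : ℕ) : Kinf := algebraMap (MvPolynomial ℕ ℚ) Kinf (X i)

/-- A letter: a `ℤ`-linear combination of the letters `x_1, x_2, …`
(the generator `i` stands for `x_{i+1}`). -/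
abbrev Letter : Type := ℕ →₀ ℤ

/-- The value of a letter under `x_i ↦ y_i`. -/
noncomputable def letterVal (l : Letter) : Kinf := l.sum fun i n => (n : Kinf) * yvar i

/-- `f(u) = 1/(n_1 y_{i_1} + ⋯ + n_k y_{i_k})` for `u = n_1 x_{i_1} + ⋯ + n_k x_{i_k} ≠ 0`,
and `f(0) = 0`. -/
noncomputable def collide (l : Letter) : Kinf := (letterVal l)⁻¹

/-- The `ш*` product of two words, as a formal `ℚ(y_1,y_2,…)`-linear combination of words:
`uω ш* vη = u(ω ш* vη) + v(uω ш* η) + f(u-v)·(u(ω ш* η) - v(ω ш* η))`. -/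
noncomputable def shMul : List Letter → List Letter → (List Letter →₀ Kinf)
  | [], η => Finsupp.single η 1
  | ω, [] => Finsupp.single ω 1
  | u :: ω, v :: η =>
      Finsupp.mapDomain (List.cons u) (shMul ω (v :: η))
        + Finsupp.mapDomain (List.cons v) (shMul (u :: ω) η)
        + collide (u - v) • (Finsupp.mapDomain (List.cons u) (shMul ω η)
            - Finsupp.mapDomain (List.cons v) (shMul ω η))
  termination_by ω η => ω.length + η.length

/-- `N^{l(α)}(α)`, evaluated with `y_i := x_i`. -/
noncomputable def wordEval (N : Mould) (α : List Letter) : Kinf :=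
  MvPolynomial.eval₂ (Rat.castHom Kinf) (fun j : Fin α.length => letterVal (α.get j))
    (N α.length)

/-- Alternility of a mould: `N^0 = 0` and for all `p, q ≥ 1`,
`Σ_α ⟨(x_1,…,x_p) ш* (x_{p+1},…,x_{p+q}) | α⟩|_{y_i := x_i} · N^{l(α)}(α) = 0`. -/
noncomputable def IsAlternil (N : Mould) : Prop :=
  N 0 = 0 ∧ ∀ p q : ℕ, 1 ≤ p → 1 ≤ q →
    (shMul ((List.range p).map fun j => Finsupp.single j 1)
           ((List.range q).map fun j => Finsupp.single (p + j) 1)).sum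
      (fun α c => c * wordEval N α) = 0

/-- Alternality in depth three, in its shuffle form `a ш bc`, at arbitrary arguments. -/
theorem IsAlternal.shuffle_one_two {M : Mould} (hal : IsAlternal M) {K : Type} [CommRing K]
    (f : ℚ →+* K) (a b c : K) :
    mEval f M ![a, b, c] + mEval f M ![b, a, c] + mEval f M ![b, c, a] = 0 := by
  classical
  have h := hal.2 1 2 le_rfl one_le_two
  rw [← Finset.sum_filter] at h
  have hS : (Finset.univ.filter fun σ : Equiv.Perm (Fin (1 + 2)) =>
      (∀ i j : Fin (1 + 2), i < j → j.val < 1 → σ.symm i < σ.symm j) ∧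
        (∀ i j : Fin (1 + 2), i < j → 1 ≤ i.val → σ.symm i < σ.symm j))
      = {1, Equiv.swap 0 1, Equiv.swap 0 1 * Equiv.swap 1 2} := by
    decide
  have h' := congrArg (eval₂Hom f ![a, b, c])
    ((Finset.sum_congr (by convert hS) fun _ _ => rfl).symm.trans h)
  have key : ∀ σ : Equiv.Perm (Fin (1 + 2)),
      eval₂Hom f ![a, b, c]
          (eval₂ C (fun i => (X (σ i) : MvPolynomial (Fin (1 + 2)) ℚ)) (M (1 + 2)))
        = mEval f M (m := 3) (fun i => ![a, b, c] (σ i)) := by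
    intro σ
    rw [hom_eval₂, mEval]
    congr 1
    · exact Subsingleton.elim _ _
    · funext i
      simp
  rw [Finset.sum_insert (by decide), Finset.sum_insert (by decide), Finset.sum_singleton,
    map_add, map_add, map_zero, key, key, key] at h'
  rw [← h', add_assoc]
  refine congrArg₂ (· + ·) ?_ (congrArg₂ (· + ·) ?_ ?_)
  all_goals
    refine congrArg (mEval f M (m := 3)) (funext fun i => ?_)
    fin_cases i <;> rfl

/-- An alternal mould is invariant under reversal of the arguments in depth three. -/
theorem IsAlternal.mEval_reverse_three {M : Mould} (hal : IsAlternal M) {K : Type} [CommRing K]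
    (f : ℚ →+* K) (a b c : K) : mEval f M ![a, b, c] = mEval f M ![c, b, a] := by
  linear_combination hal.shuffle_one_two f a b c - hal.shuffle_one_two f c b a

theorem letterVal_single (i : ℕ) : letterVal (Finsupp.single i 1) = yvar i := by
  simp [letterVal]

theorem map_mEval {K L : Type} [CommRing K] [CommRing L] (g : K →+* L) (f : ℚ →+* K)
    (f' : ℚ →+* L) (N : Mould) {m : ℕ} (v : Fin m → K) :
    g (mEval f N v) = mEval f' N (fun i => g (v i)) := by
  rw [Subsingleton.elim f' (g.comp f)]
  exact hom_eval₂ _ _ _ _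

theorem sum_mul_wordEval (N : Mould) (L : List Letter →₀ Kinf) :
    L.sum (fun α c => c * wordEval N α) = Finsupp.linearCombination Kinf (wordEval N) L := by
  simp [Finsupp.linearCombination_apply]

theorem algebraMap_mEval_C (N : Mould) {m : ℕ} (v : Fin m → MvPolynomial ℕ ℚ) :
    algebraMap (MvPolynomial ℕ ℚ) Kinf (mEval C N v)
      = mEval (Rat.castHom Kinf) N (fun i => algebraMap (MvPolynomial ℕ ℚ) Kinf (v i)) := by
  exact map_mEval _ _ _ _ _

theorem wordEval_pair (N : Mould) (i j : ℕ) :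
    wordEval N [Finsupp.single i 1, Finsupp.single j 1]
      = algebraMap (MvPolynomial ℕ ℚ) Kinf (mEval C N ![X i, X j]) := by
  rw [algebraMap_mEval_C, wordEval, mEval]
  congr 1
  funext k
  fin_cases k <;> exact letterVal_single _

theorem wordEval_triple (N : Mould) (i j k : ℕ) :
    wordEval N [Finsupp.single i 1, Finsupp.single j 1, Finsupp.single k 1]
      = algebraMap (MvPolynomial ℕ ℚ) Kinf (mEval C N ![X i, X j, X k]) := by
  rw [algebraMap_mEval_C, wordEval, mEval]
  congr 1
  funext l
  fin_cases l <;> exact letterVal_single _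

theorem collide_single_sub_single (i j : ℕ) :
    collide (Finsupp.single i 1 - Finsupp.single j 1)
      = (algebraMap (MvPolynomial ℕ ℚ) Kinf (X i - X j))⁻¹ := by
  rw [collide, letterVal, Finsupp.sum_sub_index (by intros; push_cast; ring)]
  simp [yvar]

/-- Alternility in depth three, in the form `u ш* vw` with denominators cleared, over `ℚ[y]`. -/
theorem IsAlternil.stuffle_one_two_X {N : Mould} (hN : IsAlternil N) :
    (X 0 - X 1) * (X 0 - X 2) *
        (mEval C N ![X 0, X 1, X 2] + mEval C N ![X 1, X 0, X 2] + mEval C N ![X 1, X 2, X 0])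
      + (X 0 - X 2) * (mEval C N ![X 0, X 2] - mEval C N ![X 1, X 2])
      + (X 0 - X 1) * (mEval C N ![X 1, X 0] - mEval C N ![X 1, X 2])
      = (0 : MvPolynomial ℕ ℚ) := by
  have h := hN.2 1 2 le_rfl one_le_two
  rw [sum_mul_wordEval] at h
  simp only [List.range_succ, List.range_zero, List.nil_append, List.map_cons, List.map_nil,
    List.cons_append, shMul, Finsupp.mapDomain_add, Finsupp.mapDomain_smul, Finsupp.mapDomain_sub,
    Finsupp.mapDomain_single, map_add, map_smul, map_sub, Finsupp.linearCombination_single,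
    wordEval_pair, wordEval_triple,
    collide_single_sub_single, smul_eq_mul, one_add_one_eq_two, add_zero] at h
  have ne : ∀ i j : ℕ, i ≠ j → algebraMap (MvPolynomial ℕ ℚ) Kinf (X i - X j) ≠ 0 := by
    intro i j hij
    rw [Ne, FaithfulSMul.algebraMap_eq_zero_iff, sub_eq_zero]
    exact fun e => hij (X_injective e)
  have h01 := ne 0 1 (by decide)
  have h02 := ne 0 2 (by decide)
  apply FaithfulSMul.algebraMap_injective (MvPolynomial ℕ ℚ) Kinf
  simp only [map_add, map_mul, map_sub, map_zero] at h h01 h02 ⊢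
  field_simp at h
  linear_combination h

/-- Alternility in depth three, in the form `u ш* vw`, at distinct arguments of a field. -/
theorem IsAlternil.stuffle_one_two {N : Mould} (hN : IsAlternil N) {K : Type} [Field K]
    (f : ℚ →+* K) {u v w : K} (huv : u ≠ v) (huw : u ≠ w) :
    mEval f N ![u, v, w] + mEval f N ![v, u, w] + mEval f N ![v, w, u]
      + (mEval f N ![u, w] - mEval f N ![v, w]) / (u - v)
      + (mEval f N ![v, u] - mEval f N ![v, w]) / (u - w) = 0 := by
  have h := congrArg (eval₂Hom f fun n => if n = 0 then u else if n = 1 then v else w)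
    hN.stuffle_one_two_X
  have e2 : ∀ i j : ℕ, ∀ g : ℕ → K,
      eval₂Hom f g (mEval C N ![X i, X j]) = mEval f N ![g i, g j] := by
    intro i j g
    rw [map_mEval _ _ f]
    congr 1
    funext k; fin_cases k <;> simp
  have e3 : ∀ i j l : ℕ, ∀ g : ℕ → K,
      eval₂Hom f g (mEval C N ![X i, X j, X l]) = mEval f N ![g i, g j, g l] := by
    intro i j l g
    rw [map_mEval _ _ f]
    congr 1
    funext k; fin_cases k <;> simp
  simp only [map_add, map_sub, map_mul, map_zero, e2, e3] at h
  simp at h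
  have h1 := sub_ne_zero.2 huv
  have h2 := sub_ne_zero.2 huw
  field_simp
  linear_combination h

/-- Reversing the arguments of an alternil mould in depth three. -/
theorem IsAlternil.mEval_reverse_three {N : Mould} (hN : IsAlternil N) {K : Type} [Field K]
    (f : ℚ →+* K) {u v w : K} (huv : u ≠ v) (huw : u ≠ w) (hvw : v ≠ w) :
    mEval f N ![u, v, w] = mEval f N ![w, v, u]
      + (mEval f N ![w, u] - mEval f N ![v, u]) / (w - v)
      - (mEval f N ![u, w] - mEval f N ![v, w]) / (u - v) := by
  have h1 := hN.stuffle_one_two f huv huw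
  have h2 := hN.stuffle_one_two f hvw.symm huw.symm
  have h3 : (mEval f N ![v, w] - mEval f N ![v, u]) / (w - u)
      = (mEval f N ![v, u] - mEval f N ![v, w]) / (u - w) := by
    rw [← neg_sub u w, ← neg_sub (mEval f N ![v, u]), neg_div_neg_eq]
  linear_combination h1 - h2 + h3

theorem mEval_swapM_add_C_two {K : Type} [Field K] (f : ℚ →+* K) (M : Mould) (c : ℕ → ℚ)
    (u v : K) :
    mEval f (fun m => swapM M m + C (c m)) ![u, v] = mEval f M ![v, u - v] + f (c 2) := by
  have h : eval₂ f ![u, v] (swapM M 2) = mEval f M ![v, u - v] := by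
    rw [swapM, ← coe_eval₂Hom, hom_eval₂, mEval]
    congr 1
    · exact Subsingleton.elim _ _
    · funext k; fin_cases k <;> simp
  rw [mEval, eval₂_add, eval₂_C, h]

theorem mEval_swapM_add_C_three {K : Type} [Field K] (f : ℚ →+* K) (M : Mould) (c : ℕ → ℚ)
    (u v w : K) :
    mEval f (fun m => swapM M m + C (c m)) ![u, v, w]
      = mEval f M ![w, v - w, u - v] + f (c 3) := by
  have h : eval₂ f ![u, v, w] (swapM M 3) = mEval f M ![w, v - w, u - v] := by
    rw [swapM, ← coe_eval₂Hom, hom_eval₂, mEval]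
    congr 1
    · exact Subsingleton.elim _ _
    · funext k; fin_cases k <;> simp
  rw [mEval, eval₂_add, eval₂_C, h]

theorem uEval_three {K : Type} [CommRing K] (f : ℚ →+* K) (M : Mould) (v : Fin 3 → K) :
    uEval f M v = mEval f M ![v 2 - v 0, v 1 - v 2] := by
  rw [uEval]
  congr 1
  funext k; fin_cases k <;> rfl

theorem uEval_four {K : Type} [CommRing K] (f : ℚ →+* K) (M : Mould) (a b c d : K) :
    uEval f M ![a, b, c, d] = mEval f M ![d - a, c - d, b - c] := by
  rw [uEval]
  congr 1
  funext k; fin_cases k <;> rfl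

theorem collUEval_four_one {K : Type} [Field K] (f : ℚ →+* K) (M : Mould) (a b c d : K) :
    collUEval f M (t := 2) 1 ![a, b, c, d]
      = (mEval f M ![d - a, b - d] - mEval f M ![d - a, c - d]) / (b - c) := by
  rw [collUEval, uEval_three, uEval_three]
  rfl

set_option maxHeartbeats 1000000 in
/-- Let `M` be an alternal mould with `M^0 = 0`, `M^1 = 0` such that
`swap(M) + C` is alternil for some constant mould `C`.  Then
`ũ(M)^4(x_4,x_1,x_2,x_3) = ũ(M)^4(-x_1,-x_2,-x_3,-x_4)
 + coll^4_{2,3}(ũ(M))(-x_1,-x_2,-x_3,-x_4) - coll^4_{2,3}(ũ(M))(-x_1,-x_4,-x_3,-x_2)`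
in `ℚ(x_1,x_2,x_3,x_4)`. -/
theorem uM4_push_identity (M : Mould) (h0 : M 0 = 0) (h1 : M 1 = 0)
    (hal : IsAlternal M)
    (hil : ∃ c : ℕ → ℚ, IsAlternil (fun m => swapM M m + MvPolynomial.C (c m))) :
    uEval (Rat.castHom (FF 4)) M ![xv 3, xv 0, xv 1, xv 2]
      = uEval (Rat.castHom (FF 4)) M ![-xv 0, -xv 1, -xv 2, -xv 3]
        + collUEval (Rat.castHom (FF 4)) M 1 ![-xv 0, -xv 1, -xv 2, -xv 3]
        - collUEval (Rat.castHom (FF 4)) M 1 ![-xv 0, -xv 3, -xv 2, -xv 1] := by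
  obtain ⟨c, hc⟩ := hil
  have xv_inj : ∀ i j : Fin 4, i ≠ j → (xv i : FF 4) ≠ xv j := fun i j hij e =>
    hij (X_injective (FaithfulSMul.algebraMap_injective (MvPolynomial (Fin 4) ℚ) (FF 4) e))
  have key := hc.mEval_reverse_three (Rat.castHom (FF 4))
    (u := xv 0 - xv 3) (v := xv 0 - xv 2) (w := xv 0 - xv 1)
    (fun e => xv_inj 3 2 (by decide) (sub_right_injective e))
    (fun e => xv_inj 3 1 (by decide) (sub_right_injective e))
    (fun e => xv_inj 2 1 (by decide) (sub_right_injective e))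
  simp only [mEval_swapM_add_C_two, mEval_swapM_add_C_three, add_sub_add_right_eq_sub] at key
  rw [uEval_four, uEval_four, collUEval_four_one, collUEval_four_one,
    hal.mEval_reverse_three]
  simp only [sub_sub_sub_cancel_left] at key
  simp only [neg_sub_neg]
  linear_combination key
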